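/- In every dendriform dialgebra D over a field of characteristic 0, the pre-Lie triple products satisfy the following multilinear identity of degree 5: for all a, b, c, d, e ∈ D, [[a,b,c]_1, d, e]_1 − [[a,d,b]_1, c, e]_1 + [[a,d,c]_1, b, e]_1 − [[a,c,b]_1, d, e]_1 − [a, [b,c,d]_1, e]_1 + [a, [d,b,c]_1, e]_1 − [a, [d,c,b]_1, e]_1 + [a, [c,b,d]_1, e]_1 = 0. -/

import Mathlib

/-- A dendriform dialgebra over a field `F`: a vector space with two bilinear
operations `≺` (`prec`) and `≻` (`succ`) satisfying the dendriform axioms. -/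
structure DendriformDialgebra (F : Type*) [Field F] where
  carrier : Type*
  [addCommGroup : AddCommGroup carrier]
  [module : Module F carrier]
  prec : carrier →ₗ[F] carrier →ₗ[F] carrier
  succ : carrier →ₗ[F] carrier →ₗ[F] carrier
  prec_prec : ∀ x y z, prec (prec x y) z = prec x (prec y z) + prec x (succ y z)
  inner_assoc : ∀ x y z, prec (succ x y) z = succ x (prec y z)
  succ_succ : ∀ x y z, succ x (succ y z) = succ (succ x y) z + succ (prec x y) z

attribute [instance] DendriformDialgebra.addCommGroup DendriformDialgebra.module

namespace DendriformDialgebra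

variable {F : Type*} [Field F] (A : DendriformDialgebra F)

/-- The pre-Lie product `a · b = a ≺ b − b ≻ a`. -/
def preLie (x y : A.carrier) : A.carrier := A.prec x y - A.succ y x

/-- The first pre-Lie triple product `[a,b,c]₁ = (a · b) · c`. -/
def plt1 (x y z : A.carrier) : A.carrier := A.preLie (A.preLie x y) z

/-- The second pre-Lie triple product `[a,b,c]₂ = a · (b · c)`. -/
def plt2 (x y z : A.carrier) : A.carrier := A.preLie x (A.preLie y z)

/-- The pre-Jordan product `a · b = a ≻ b + b ≺ a`. -/
def preJordan (x y : A.carrier) : A.carrier := A.succ x y + A.prec y x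

/-- The first pre-Jordan triple product `⟨a,b,c⟩₁ = (a · b) · c`. -/
def pjt1 (x y z : A.carrier) : A.carrier := A.preJordan (A.preJordan x y) z

/-- The second pre-Jordan triple product `⟨a,b,c⟩₂ = a · (b · c)`. -/
def pjt2 (x y z : A.carrier) : A.carrier := A.preJordan x (A.preJordan y z)

end DendriformDialgebra

open DendriformDialgebra

theorem DendriformDialgebra.preLie_sub_left {F : Type*} [Field F] (A : DendriformDialgebra F)
    (x y z : A.carrier) : A.preLie (x - y) z = A.preLie x z - A.preLie y z := by
  simp only [preLie, map_sub, LinearMap.sub_apply]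
  abel

theorem DendriformDialgebra.preLie_sub_right {F : Type*} [Field F] (A : DendriformDialgebra F)
    (x y z : A.carrier) : A.preLie x (y - z) = A.preLie x y - A.preLie x z := by
  simp only [preLie, map_sub, LinearMap.sub_apply]
  abel

/-- The right pre-Lie identity `x · [y,z] = (x · y) · z - (x · z) · y`. -/
theorem DendriformDialgebra.preLie_comm {F : Type*} [Field F] (A : DendriformDialgebra F)
    (x y z : A.carrier) : A.preLie x (A.preLie y z - A.preLie z y) =
      A.preLie (A.preLie x y) z - A.preLie (A.preLie x z) y := by
  simp only [preLie, map_sub, LinearMap.sub_apply, A.prec_prec, A.inner_assoc, A.succ_succ]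
  abel

theorem preLie_triple_identity_degree5_second
    {F : Type*} [Field F] [CharZero F] (A : DendriformDialgebra F)
    (a b c d e : A.carrier) :
    A.plt1 (A.plt1 a b c) d e - A.plt1 (A.plt1 a d b) c e
      + A.plt1 (A.plt1 a d c) b e - A.plt1 (A.plt1 a c b) d e
      - A.plt1 a (A.plt1 b c d) e + A.plt1 a (A.plt1 d b c) e
      - A.plt1 a (A.plt1 d c b) e + A.plt1 a (A.plt1 c b d) e = 0 := by
  have h1 := A.preLie_comm a b c
  have h2 := A.preLie_comm (A.preLie a d) b c
  have h3 := A.preLie_comm a (A.preLie b c - A.preLie c b) d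
  rw [A.preLie_comm d b c, h1, h2] at h3
  have h4 := congrArg (fun t => A.preLie t e) h3
  simp only [preLie_sub_left, preLie_sub_right] at h4
  simp only [plt1]
  rw [← sub_eq_zero] at h4
  rw [← neg_eq_zero, ← h4]
  abel
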